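/- For every ζ ∈ C⁴(ℝ^n) and every η ∈ C_c^∞(ℝ^n), one has the identity ∫_{ℝ^n} (Δ²ζ) ζ η² dx = ∫_{ℝ^n} [Δ(ζη)]² dx + ∫_{ℝ^n} [ −4(∇ζ·∇η)² + 2 ζ Δζ |∇η|² ] dx + ∫_{ℝ^n} ζ² [ 2 ∇(Δη)·∇η + (Δη)² ] dx. -/

import Mathlib

open MeasureTheory Metric Set Filter
open scoped RealInnerProductSpace Topology

noncomputable section

/-- The Laplacian of `u : ℝⁿ → ℝ` at `x`, as the sum of the pure second
partial derivatives in the coordinate directions. -/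
def lap (n : ℕ) (u : EuclideanSpace ℝ (Fin n) → ℝ) (x : EuclideanSpace ℝ (Fin n)) : ℝ :=
  ∑ i : Fin n, iteratedFDeriv ℝ 2 u x ![EuclideanSpace.single i 1, EuclideanSpace.single i 1]

/-- `u` solves `Δ²u = |x|^a |u|^(p-1) u` pointwise on `Ω`. -/
def IsSolutionOn (n : ℕ) (a p : ℝ) (u : EuclideanSpace ℝ (Fin n) → ℝ)
    (Ω : Set (EuclideanSpace ℝ (Fin n))) : Prop :=
  ∀ x ∈ Ω, lap n (lap n u) x = ‖x‖ ^ a * |u x| ^ (p - 1) * u x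

/-- `u` is a stable solution on `Ω`:
`p ∫ |x|^a |u|^(p-1) ψ² ≤ ∫ (Δψ)²` for every test function `ψ ∈ C_c^∞(Ω)`. -/
def StableOn (n : ℕ) (a p : ℝ) (u : EuclideanSpace ℝ (Fin n) → ℝ)
    (Ω : Set (EuclideanSpace ℝ (Fin n))) : Prop :=
  ∀ ψ : EuclideanSpace ℝ (Fin n) → ℝ, ContDiff ℝ (⊤ : ℕ∞) ψ → HasCompactSupport ψ →
    tsupport ψ ⊆ Ω →
    p * ∫ x, ‖x‖ ^ a * |u x| ^ (p - 1) * ψ x ^ 2 ≤ ∫ x, lap n ψ x ^ 2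

/-- Surface integral of `f` over the sphere `∂B_r(x)`, with respect to the
`(n-1)`-dimensional Hausdorff measure. -/
def sphInt (n : ℕ) (x : EuclideanSpace ℝ (Fin n)) (r : ℝ)
    (f : EuclideanSpace ℝ (Fin n) → ℝ) : ℝ :=
  ∫ y in sphere x r, f y ∂(Measure.hausdorffMeasure ((n : ℝ) - 1))

/-- Radial derivative of `u` at `y`, relative to the center `x`. -/
def radDeriv (n : ℕ) (x : EuclideanSpace ℝ (Fin n))
    (u : EuclideanSpace ℝ (Fin n) → ℝ) (y : EuclideanSpace ℝ (Fin n)) : ℝ :=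
  ⟪gradient u y, ‖y - x‖⁻¹ • (y - x)⟫

/-- `ℓ₁ = (β+2)(n-4-β) + β(n-2-β)` with `β = (4+a)/(p-1)`. -/
def ell1 (n : ℕ) (a p : ℝ) : ℝ :=
  let β : ℝ := (4 + a) / (p - 1)
  (β + 2) * ((n : ℝ) - 4 - β) + β * ((n : ℝ) - 2 - β)

/-- `ℓ₂ = β(β+2)(n-4-β)(n-2-β)` with `β = (4+a)/(p-1)`. -/
def ell2 (n : ℕ) (a p : ℝ) : ℝ :=
  let β : ℝ := (4 + a) / (p - 1)
  β * (β + 2) * ((n : ℝ) - 4 - β) * ((n : ℝ) - 2 - β)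

/-- The constant `c(n,p,a) = 2(ρ - γ - 1)`, `ρ = n-1-2β`, `γ = β(β-n+2)`. -/
def cConst (n : ℕ) (a p : ℝ) : ℝ :=
  let β : ℝ := (4 + a) / (p - 1)
  2 * (((n : ℝ) - 1 - 2 * β) - β * (β - (n : ℝ) + 2) - 1)

/-- The rescaled energy `E(r; x, u)` from the monotonicity formula. -/
def energyE (n : ℕ) (a p : ℝ) (u : EuclideanSpace ℝ (Fin n) → ℝ)
    (x : EuclideanSpace ℝ (Fin n)) (r : ℝ) : ℝ :=
  let β : ℝ := (4 + a) / (p - 1)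
  r ^ (2 * β + 4 - (n : ℝ)) *
      (∫ y in ball x r,
        (1 / 2) * lap n u y ^ 2 - (1 / (p + 1)) * ‖y‖ ^ a * |u y| ^ (p + 1))
    + β / 2 * ((n : ℝ) - 2 - β) *
        deriv (fun ρ : ℝ => ρ ^ (2 * β + 1 - (n : ℝ)) * sphInt n x ρ fun y => u y ^ 2) r
    + β / 2 * ((n : ℝ) - 2 - β) *
        deriv (fun ρ : ℝ => ρ ^ (2 * β + 2 - (n : ℝ)) * sphInt n x ρ fun y => u y ^ 2) r
    + r ^ 3 / 2 *
        deriv (fun ρ : ℝ => ρ ^ (2 * β + 1 - (n : ℝ)) *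
          sphInt n x ρ fun y => (β * ρ⁻¹ * u y + radDeriv n x u y) ^ 2) r
    + 1 / 2 *
        deriv (fun ρ : ℝ => ρ ^ (2 * β + 4 - (n : ℝ)) *
          sphInt n x ρ fun y => ‖gradient u y‖ ^ 2 - radDeriv n x u y ^ 2) r
    + 1 / 2 * r ^ (2 * β + 3 - (n : ℝ)) *
        (sphInt n x r fun y => ‖gradient u y‖ ^ 2 - radDeriv n x u y ^ 2)

end

/-- The partial derivative of `u` in the `i`-th coordinate direction. -/
noncomputable def partialDeriv {n : ℕ} (i : Fin n) (u : EuclideanSpace ℝ (Fin n) → ℝ)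
    (x : EuclideanSpace ℝ (Fin n)) : ℝ :=
  fderiv ℝ u x (EuclideanSpace.single i 1)

section PartialDeriv

variable {n : ℕ} {i : Fin n} {u v : EuclideanSpace ℝ (Fin n) → ℝ} {x : EuclideanSpace ℝ (Fin n)}

theorem ContDiff.partialDeriv {m k : WithTop ℕ∞} (hu : ContDiff ℝ k u) (h : m + 1 ≤ k) :
    ContDiff ℝ m (partialDeriv i u) :=
  (hu.fderiv_right h).clm_apply contDiff_const

theorem HasCompactSupport.partialDeriv (hu : HasCompactSupport u) :
    HasCompactSupport (partialDeriv i u) :=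
  hu.fderiv_apply (𝕜 := ℝ) _

theorem partialDeriv_mul (hu : DifferentiableAt ℝ u x) (hv : DifferentiableAt ℝ v x) :
    partialDeriv i (fun y => u y * v y) x
      = u x * partialDeriv i v x + partialDeriv i u x * v x := by
  simp [partialDeriv, fderiv_fun_mul hu hv, mul_comm]

theorem partialDeriv_sub (hu : DifferentiableAt ℝ u x) (hv : DifferentiableAt ℝ v x) :
    partialDeriv i (fun y => u y - v y) x = partialDeriv i u x - partialDeriv i v x := by
  simp [partialDeriv, fderiv_fun_sub hu hv]

theorem partialDeriv_add (hu : DifferentiableAt ℝ u x) (hv : DifferentiableAt ℝ v x) :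
    partialDeriv i (fun y => u y + v y) x = partialDeriv i u x + partialDeriv i v x := by
  simp [partialDeriv, fderiv_fun_add hu hv]

theorem partialDeriv_partialDeriv_mul (hu : ContDiff ℝ 2 u) (hv : ContDiff ℝ 2 v) :
    partialDeriv i (partialDeriv i fun y => u y * v y) x
      = u x * partialDeriv i (partialDeriv i v) x
        + 2 * (partialDeriv i u x * partialDeriv i v x)
        + partialDeriv i (partialDeriv i u) x * v x := by
  have du := hu.differentiable (by norm_num)
  have dv := hv.differentiable (by norm_num)
  have du' : Differentiable ℝ (partialDeriv i u) :=
    (hu.partialDeriv (m := 1) (by norm_num)).differentiable (by norm_num)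
  have dv' : Differentiable ℝ (partialDeriv i v) :=
    (hv.partialDeriv (m := 1) (by norm_num)).differentiable (by norm_num)
  have h : (partialDeriv i fun y => u y * v y)
      = fun y => u y * partialDeriv i v y + partialDeriv i u y * v y :=
    funext fun y => partialDeriv_mul (du y) (dv y)
  rw [h, partialDeriv_add ((du x).fun_mul (dv' x)) ((du' x).fun_mul (dv x)),
    partialDeriv_mul (du x) (dv' x), partialDeriv_mul (du' x) (dv x)]
  ring

theorem lap_eq_sum_partialDeriv (hu : ContDiff ℝ 2 u) :
    lap n u x = ∑ i, partialDeriv i (partialDeriv i u) x := by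
  have h : DifferentiableAt ℝ (fderiv ℝ u) x :=
    (hu.fderiv_right (m := 1) (by norm_num)).differentiable (by norm_num) x
  refine Finset.sum_congr rfl fun i _ => ?_
  rw [iteratedFDeriv_two_apply]
  unfold partialDeriv
  simp [fderiv_clm_apply h (differentiableAt_const _)]

theorem ContDiff.lap {m k : WithTop ℕ∞} (hu : ContDiff ℝ k u) (h : m + 1 + 1 ≤ k) :
    ContDiff ℝ m (lap n u) := by
  have h2 : ContDiff ℝ 2 u := hu.of_le <| le_trans
    (by rw [add_assoc, one_add_one_eq_two]; exact le_add_self) h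
  have h3 : _root_.lap n u = fun x => ∑ i, _root_.partialDeriv i (_root_.partialDeriv i u) x :=
    funext fun x => lap_eq_sum_partialDeriv h2
  rw [h3]
  exact ContDiff.sum fun i _ => (hu.partialDeriv h).partialDeriv le_rfl

theorem lap_mul (hu : ContDiff ℝ 2 u) (hv : ContDiff ℝ 2 v) :
    lap n (fun y => u y * v y) x
      = u x * lap n v x + 2 * ∑ i, partialDeriv i u x * partialDeriv i v x + lap n u x * v x := by
  simp only [lap_eq_sum_partialDeriv (hu.mul hv), lap_eq_sum_partialDeriv hu,
    lap_eq_sum_partialDeriv hv, partialDeriv_partialDeriv_mul hu hv, Finset.sum_add_distrib,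
    Finset.mul_sum, Finset.sum_mul]

theorem HasCompactSupport.lap (hu : HasCompactSupport u) : HasCompactSupport (lap n u) := by
  refine (hu.iteratedFDeriv (𝕜 := ℝ) 2).mono fun x hx h => hx ?_
  simp [_root_.lap, h]

theorem inner_gradient_gradient :
    ⟪gradient u x, gradient v x⟫ = ∑ i, partialDeriv i u x * partialDeriv i v x := by
  have h (w : EuclideanSpace ℝ (Fin n) → ℝ) (i : Fin n) :
      gradient w x i = partialDeriv i w x := by
    rw [partialDeriv, ← InnerProductSpace.toDual_symm_apply, EuclideanSpace.inner_single_right]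
    simp [gradient]
  rw [PiLp.inner_apply]
  exact Finset.sum_congr rfl fun i _ => by simp [h, mul_comm]

theorem continuous_inner_gradient (hu : ContDiff ℝ 1 u) (hv : ContDiff ℝ 1 v) :
    Continuous fun x => ⟪gradient u x, gradient v x⟫ := by
  simp only [inner_gradient_gradient]
  exact continuous_finsetSum _ fun i _ =>
    (hu.partialDeriv (m := 0) (by norm_num)).continuous.mul
      (hv.partialDeriv (m := 0) (by norm_num)).continuous

theorem HasCompactSupport.gradient (hu : HasCompactSupport u) :
    HasCompactSupport (gradient u) := by
  refine (hu.fderiv (𝕜 := ℝ)).mono fun x hx h => hx ?_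
  simp [_root_.gradient, h]

theorem integrable_partialDeriv (hu : ContDiff ℝ 1 u) (hc : HasCompactSupport u) :
    Integrable (partialDeriv i u) :=
  (hu.partialDeriv (m := 0) (by norm_num)).continuous.integrable_of_hasCompactSupport
    hc.partialDeriv

theorem integral_partialDeriv_eq_zero (hu : ContDiff ℝ 1 u) (hc : HasCompactSupport u) :
    ∫ x, partialDeriv i u x = 0 := by
  have := integral_mul_fderiv_eq_neg_fderiv_mul_of_integrable (μ := volume)
    (f := fun _ : EuclideanSpace ℝ (Fin n) => (1 : ℝ)) (g := u)
    (v := EuclideanSpace.single i 1) (by simp)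
    (by simp only [one_mul]; exact integrable_partialDeriv (i := i) hu hc)
    (by simpa using hu.continuous.integrable_of_hasCompactSupport hc)
    (fun x _ => differentiableAt_const _) (fun x _ => hu.differentiable (by norm_num) x)
  simpa [partialDeriv] using this

end PartialDeriv

/-- The `i`-th component of a vector field whose divergence is the difference of the integrands
in `stmt5`. -/
noncomputable def bilapFlux {n : ℕ} (ζ η : EuclideanSpace ℝ (Fin n) → ℝ) (i : Fin n)
    (x : EuclideanSpace ℝ (Fin n)) : ℝ :=
  partialDeriv i (lap n ζ) x * (ζ x * (η x * η x))
    - lap n ζ x * partialDeriv i (fun y => ζ y * (η y * η y)) x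
    - 2 * (ζ x * ζ x * (lap n η x * partialDeriv i η x))

section BilapFlux

variable {n : ℕ} {ζ η : EuclideanSpace ℝ (Fin n) → ℝ}

theorem contDiff_bilapFlux (hζ : ContDiff ℝ 4 ζ) (hη : ContDiff ℝ 4 η) (i : Fin n) :
    ContDiff ℝ 1 (bilapFlux ζ η i) := by
  have hζ1 : ContDiff ℝ 1 ζ := hζ.of_le (by norm_num)
  have hη1 : ContDiff ℝ 1 η := hη.of_le (by norm_num)
  have hL : ContDiff ℝ 2 (lap n ζ) := hζ.lap (by norm_num)
  have hM : ContDiff ℝ 1 (lap n η) := hη.lap (by norm_num)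
  have hg : ContDiff ℝ 4 fun y => ζ y * (η y * η y) := hζ.mul (hη.mul hη)
  exact (((hL.partialDeriv (by norm_num)).mul (hζ1.mul (hη1.mul hη1))).sub
    ((hL.of_le (by norm_num)).mul (hg.partialDeriv (by norm_num)))).sub
    (contDiff_const.mul ((hζ1.mul hζ1).mul (hM.mul (hη.partialDeriv (by norm_num)))))

theorem hasCompactSupport_bilapFlux (hη : HasCompactSupport η) (i : Fin n) :
    HasCompactSupport (bilapFlux ζ η i) := by
  have hg : HasCompactSupport fun y => ζ y * (η y * η y) := (hη.mul_left (f := η)).mul_left (f := ζ)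
  exact ((hg.mul_left (f := partialDeriv i (lap n ζ))).sub
    (hg.partialDeriv.mul_left (f := lap n ζ))).sub
    (((hη.partialDeriv.mul_left (f := lap n η)).mul_left (f := fun x => ζ x * ζ x)).mul_left
      (f := fun _ => 2))

theorem partialDeriv_bilapFlux (hζ : ContDiff ℝ 4 ζ) (hη : ContDiff ℝ 4 η) (i : Fin n)
    (x : EuclideanSpace ℝ (Fin n)) :
    partialDeriv i (bilapFlux ζ η i) x
      = partialDeriv i (partialDeriv i (lap n ζ)) x * (ζ x * (η x * η x))
        - lap n ζ x * partialDeriv i (partialDeriv i fun y => ζ y * (η y * η y)) x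
        - 4 * ζ x * lap n η x * (partialDeriv i ζ x * partialDeriv i η x)
        - 2 * ζ x ^ 2 * (partialDeriv i (lap n η) x * partialDeriv i η x)
        - 2 * ζ x ^ 2 * lap n η x * partialDeriv i (partialDeriv i η) x := by
  have hL : ContDiff ℝ 2 (lap n ζ) := hζ.lap (by norm_num)
  have hM : ContDiff ℝ 2 (lap n η) := hη.lap (by norm_num)
  have hg : ContDiff ℝ 4 fun y => ζ y * (η y * η y) := hζ.mul (hη.mul hη)
  have dζ := hζ.differentiable (by norm_num) x
  have dη' := (hη.partialDeriv (i := i) (m := 1) (by norm_num)).differentiable (by norm_num) x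
  have dL := hL.differentiable (by norm_num) x
  have dM := hM.differentiable (by norm_num) x
  have dL' := (hL.partialDeriv (i := i) (m := 1) (by norm_num)).differentiable (by norm_num) x
  have dg := hg.differentiable (by norm_num) x
  have dg' := (hg.partialDeriv (i := i) (m := 1) (by norm_num)).differentiable (by norm_num) x
  have d2 : DifferentiableAt ℝ (fun _ : EuclideanSpace ℝ (Fin n) => (2 : ℝ)) x :=
    differentiableAt_const _
  have h2 : partialDeriv i (fun _ : EuclideanSpace ℝ (Fin n) => (2 : ℝ)) x = 0 := by
    simp [partialDeriv]
  unfold bilapFlux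
  rw [partialDeriv_sub ((dL'.fun_mul dg).fun_sub (dL.fun_mul dg'))
      (d2.fun_mul ((dζ.fun_mul dζ).fun_mul (dM.fun_mul dη'))),
    partialDeriv_sub (dL'.fun_mul dg) (dL.fun_mul dg'),
    partialDeriv_mul dL' dg, partialDeriv_mul dL dg',
    partialDeriv_mul d2 ((dζ.fun_mul dζ).fun_mul (dM.fun_mul dη')),
    partialDeriv_mul (dζ.fun_mul dζ) (dM.fun_mul dη'), partialDeriv_mul dM dη',
    partialDeriv_mul dζ dζ, h2]
  ring

theorem sum_partialDeriv_bilapFlux (hζ : ContDiff ℝ 4 ζ) (hη : ContDiff ℝ 4 η)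
    (x : EuclideanSpace ℝ (Fin n)) :
    ∑ i, partialDeriv i (bilapFlux ζ η i) x
      = lap n (lap n ζ) x * ζ x * η x ^ 2
        - (lap n (fun y => ζ y * η y) x ^ 2
          + ((-4) * ⟪gradient ζ x, gradient η x⟫ ^ 2 + 2 * ζ x * lap n ζ x * ‖gradient η x‖ ^ 2)
          + ζ x ^ 2 * (2 * ⟪gradient (lap n η) x, gradient η x⟫ + lap n η x ^ 2)) := by
  have hζ2 : ContDiff ℝ 2 ζ := hζ.of_le (by norm_num)
  have hη2 : ContDiff ℝ 2 η := hη.of_le (by norm_num)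
  have hL : ContDiff ℝ 2 (lap n ζ) := hζ.lap (by norm_num)
  have hηη : ContDiff ℝ 2 fun y => η y * η y := hη2.mul hη2
  have hprod : ∑ i, partialDeriv i ζ x * partialDeriv i (fun y => η y * η y) x
      = 2 * η x * ∑ i, partialDeriv i ζ x * partialDeriv i η x := by
    rw [Finset.mul_sum]
    refine Finset.sum_congr rfl fun i _ => ?_
    have dη := hη.differentiable (by norm_num) x
    rw [partialDeriv_mul dη dη]
    ring
  simp only [partialDeriv_bilapFlux hζ hη, Finset.sum_sub_distrib, ← Finset.mul_sum,
    ← Finset.sum_mul, ← lap_eq_sum_partialDeriv hL, ← lap_eq_sum_partialDeriv hη2,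
    ← lap_eq_sum_partialDeriv (hζ2.mul hηη), lap_mul hζ2 hηη, lap_mul hη2 hη2, lap_mul hζ2 hη2,
    hprod, ← real_inner_self_eq_norm_sq, inner_gradient_gradient]
  ring

end BilapFlux

/-- Lemma 2.1, identity (2.14):
`∫ (Δ²ζ) ζ η² = ∫ [Δ(ζη)]² + ∫ [-4(∇ζ·∇η)² + 2ζ Δζ |∇η|²] + ∫ ζ² [2∇(Δη)·∇η + (Δη)²]`. -/
theorem stmt5 (n : ℕ) (hn : 1 ≤ n)
    (ζ η : EuclideanSpace ℝ (Fin n) → ℝ)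
    (hζ : ContDiff ℝ 4 ζ) (hη : ContDiff ℝ (⊤ : ℕ∞) η) (hηc : HasCompactSupport η) :
    (∫ x : EuclideanSpace ℝ (Fin n), lap n (lap n ζ) x * ζ x * η x ^ 2) =
      (∫ x : EuclideanSpace ℝ (Fin n), lap n (fun y => ζ y * η y) x ^ 2)
      + (∫ x : EuclideanSpace ℝ (Fin n),
          (-4) * ⟪gradient ζ x, gradient η x⟫ ^ 2
            + 2 * ζ x * lap n ζ x * ‖gradient η x‖ ^ 2)
      + ∫ x : EuclideanSpace ℝ (Fin n),
          ζ x ^ 2 * (2 * ⟪gradient (lap n η) x, gradient η x⟫ + lap n η x ^ 2) := by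
  have hη4 : ContDiff ℝ 4 η := contDiff_infty.mp hη 4
  have hL : ContDiff ℝ 2 (lap n ζ) := hζ.lap (by norm_num)
  have hM : ContDiff ℝ 2 (lap n η) := hη4.lap (by norm_num)
  have hLL : Continuous (lap n (lap n ζ)) := (hL.lap (m := 0) (by norm_num)).continuous
  have hζη : Continuous (lap n fun y => ζ y * η y) :=
    ((hζ.mul hη4).lap (m := 0) (by norm_num)).continuous
  have hζ1 : ContDiff ℝ 1 ζ := hζ.of_le (by norm_num)
  have hη1 : ContDiff ℝ 1 η := hη4.of_le (by norm_num)
  have cP := continuous_inner_gradient hζ1 hη1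
  have cQ := continuous_inner_gradient (hM.of_le (by norm_num)) hη1
  have cN : Continuous fun x => ‖gradient η x‖ ^ 2 := by
    simpa only [real_inner_self_eq_norm_sq] using continuous_inner_gradient hη1 hη1
  have cζ := hζ.continuous
  have cη := hη.continuous
  have cL := hL.continuous
  have cM := hM.continuous
  have hζηc : HasCompactSupport fun y => ζ y * η y := hηc.mul_left (f := ζ)
  have i1 : Integrable fun x => lap n (lap n ζ) x * ζ x * η x ^ 2 := by
    refine Continuous.integrable_of_hasCompactSupport (by fun_prop) (hηc.mono fun x hx h => hx ?_)
    simp [h]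
  have i2 : Integrable fun x => lap n (fun y => ζ y * η y) x ^ 2 := by
    refine Continuous.integrable_of_hasCompactSupport (by fun_prop)
      (hζηc.lap.mono fun x hx h => hx ?_)
    simpa using h
  have i3 : Integrable fun x => (-4) * ⟪gradient ζ x, gradient η x⟫ ^ 2
      + 2 * ζ x * lap n ζ x * ‖gradient η x‖ ^ 2 := by
    refine Continuous.integrable_of_hasCompactSupport (by fun_prop)
      (hηc.gradient.mono fun x hx h => hx ?_)
    simp [h]
  have i4 : Integrable fun x =>
      ζ x ^ 2 * (2 * ⟪gradient (lap n η) x, gradient η x⟫ + lap n η x ^ 2) := by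
    refine Continuous.integrable_of_hasCompactSupport (by fun_prop)
      (HasCompactSupport.mul_left (HasCompactSupport.add ?_ ?_))
    · exact hηc.gradient.mono fun x hx h => hx (by simp [h])
    · exact hηc.lap.mono fun x hx h => hx (by simp [h])
  rw [← integral_add i2 i3, ← integral_add (i2.fun_add i3) i4, ← sub_eq_zero,
    ← integral_sub i1 ((i2.fun_add i3).fun_add i4)]
  simp only [← sum_partialDeriv_bilapFlux hζ hη4]
  rw [integral_finsetSum _ fun i _ => integrable_partialDeriv (contDiff_bilapFlux hζ hη4 i)
    (hasCompactSupport_bilapFlux hηc i)]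
  exact Finset.sum_eq_zero fun i _ => integral_partialDeriv_eq_zero
    (contDiff_bilapFlux hζ hη4 i) (hasCompactSupport_bilapFlux hηc i)
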